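/- For every g ∈ 𝒴 there exists a unique f ∈ 𝒴 such that L₊f = g, i.e. −f''(x) + f(x) − 5Q(x)^4 f(x) = g(x) for all x ∈ ℝ. -/

import Mathlib

open Real

/-- The ground state `Q x = 3^(1/4) (sech (2x))^(1/2)`. -/
noncomputable def Q (x : ℝ) : ℝ :=
  (3 : ℝ) ^ ((1 : ℝ) / 4) * (1 / Real.cosh (2 * x)) ^ ((1 : ℝ) / 2)

/-- The class `𝒴`: even, smooth functions all of whose derivatives are bounded by
`C (1+|x|)^κ Q(x)`. -/
def MemY (f : ℝ → ℝ) : Prop :=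
  (∀ x : ℝ, f (-x) = f x) ∧ ContDiff ℝ (⊤ : ℕ∞) f ∧
    ∀ k : ℕ, ∃ C κ : ℝ, 0 < C ∧ 0 < κ ∧
      ∀ x : ℝ, |iteratedDeriv k f x| ≤ C * (1 + |x|) ^ κ * Q x

open MeasureTheory Set

/-! ### The decay scale -/

/-- The profile `sech(2x)^(1/2)`, a constant multiple of `Q`. -/
noncomputable def sechSqrt (x : ℝ) : ℝ := (Real.cosh (2 * x)) ^ (-(1 / 2) : ℝ)

lemma sechSqrt_pos (x : ℝ) : 0 < sechSqrt x := Real.rpow_pos_of_pos (Real.cosh_pos _) _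

lemma sechSqrt_sq_mul_cosh (x : ℝ) : sechSqrt x ^ 2 * Real.cosh (2 * x) = 1 := by
  have h := Real.cosh_pos (2 * x)
  rw [sechSqrt, ← Real.rpow_natCast, ← Real.rpow_mul h.le]
  norm_num
  rw [Real.rpow_neg_one]
  field_simp

lemma sechSqrt_neg (x : ℝ) : sechSqrt (-x) = sechSqrt x := by
  simp [sechSqrt, Real.cosh_neg]

lemma sechSqrt_sq (x : ℝ) : sechSqrt x ^ 2 = 1 / Real.cosh (2 * x) := by
  have h := Real.cosh_pos (2 * x)
  rw [eq_div_iff h.ne', sechSqrt_sq_mul_cosh]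

lemma Q_eq_sechSqrt (x : ℝ) : Q x = (3 : ℝ) ^ ((1 : ℝ) / 4) * sechSqrt x := by
  rw [Q, sechSqrt, one_div (Real.cosh _), Real.inv_rpow (Real.cosh_pos _).le,
    Real.rpow_neg (Real.cosh_pos _).le]

lemma Q_pow_four (x : ℝ) : Q x ^ 4 = 3 * sechSqrt x ^ 4 := by
  rw [Q_eq_sechSqrt, mul_pow, ← Real.rpow_natCast, ← Real.rpow_mul (by norm_num)]
  norm_num

lemma contDiff_sechSqrt : ContDiff ℝ (⊤ : ℕ∞) sechSqrt := by
  unfold sechSqrt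
  refine ContDiff.rpow_const_of_ne ?_ fun x => (Real.cosh_pos _).ne'
  exact Real.contDiff_cosh.comp (contDiff_const.mul contDiff_id)

lemma hasDerivAt_cosh_two_mul (x : ℝ) :
    HasDerivAt (fun x => Real.cosh (2 * x)) (2 * Real.sinh (2 * x)) x := by
  simpa [mul_comm] using ((hasDerivAt_id x).const_mul 2).cosh

lemma hasDerivAt_sinh_two_mul (x : ℝ) :
    HasDerivAt (fun x => Real.sinh (2 * x)) (2 * Real.cosh (2 * x)) x := by
  simpa [mul_comm] using ((hasDerivAt_id x).const_mul 2).sinh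

lemma hasDerivAt_sechSqrt (x : ℝ) :
    HasDerivAt sechSqrt (-(Real.sinh (2 * x) * sechSqrt x ^ 3)) x := by
  have hd : DifferentiableAt ℝ sechSqrt x :=
    (contDiff_sechSqrt.differentiable (by simp)).differentiableAt
  have h1 := (hd.hasDerivAt.pow 2).mul (hasDerivAt_cosh_two_mul x)
  have h2 : HasDerivAt (sechSqrt ^ 2 * fun x => Real.cosh (2 * x)) 0 x := by
    have : (sechSqrt ^ 2 * fun x => Real.cosh (2 * x)) = fun _ => (1 : ℝ) := by
      funext y
      exact sechSqrt_sq_mul_cosh y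
    rw [this]
    exact hasDerivAt_const x 1
  have h3 := h1.unique h2
  have h4 := sechSqrt_sq_mul_cosh x
  have hw := sechSqrt_pos x
  have : deriv sechSqrt x = -(Real.sinh (2 * x) * sechSqrt x ^ 3) := by
    simp only [Pi.pow_apply, Nat.cast_ofNat, Nat.add_one_sub_one, pow_one] at h3
    have h5 : 2 * sechSqrt x * Real.cosh (2 * x) *
        (deriv sechSqrt x + Real.sinh (2 * x) * sechSqrt x ^ 3) = 0 := by
      linear_combination h3 + 2 * Real.sinh (2 * x) * sechSqrt x ^ 2 * h4
    have h6 : 2 * sechSqrt x * Real.cosh (2 * x) ≠ 0 := by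
      have := Real.cosh_pos (2 * x)
      positivity
    linarith [(mul_eq_zero.mp h5).resolve_left h6]
  rw [← this]
  exact hd.hasDerivAt

lemma abs_sinh_le_cosh (x : ℝ) : |Real.sinh x| ≤ Real.cosh x :=
  abs_le_of_sq_le_sq (by linarith [Real.cosh_sq x]) (Real.cosh_pos x).le

/-! ### The homogeneous solutions -/

/-- The odd solution of `L₊ u = 0`, proportional to the derivative of `Q`. -/
noncomputable def oddSol (x : ℝ) : ℝ := Real.sinh (2 * x) * sechSqrt x ^ 3

/-- The even solution of `L₊ u = 0`. -/
noncomputable def evenSol (x : ℝ) : ℝ := (Real.cosh (2 * x) ^ 2 - 2) * sechSqrt x ^ 3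

/-- The derivative of `oddSol`. -/
noncomputable def oddSolDeriv (x : ℝ) : ℝ :=
  2 * Real.cosh (2 * x) * sechSqrt x ^ 3 - 3 * Real.sinh (2 * x) ^ 2 * sechSqrt x ^ 5

/-- The derivative of `evenSol`. -/
noncomputable def evenSolDeriv (x : ℝ) : ℝ :=
  4 * Real.cosh (2 * x) * Real.sinh (2 * x) * sechSqrt x ^ 3
    - 3 * (Real.cosh (2 * x) ^ 2 - 2) * Real.sinh (2 * x) * sechSqrt x ^ 5

lemma hasDerivAt_oddSol (x : ℝ) : HasDerivAt oddSol (oddSolDeriv x) x := by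
  refine ((hasDerivAt_sinh_two_mul x).fun_mul ((hasDerivAt_sechSqrt x).fun_pow 3)).congr_deriv ?_
  simp only [oddSolDeriv, Nat.cast_ofNat, Nat.add_one_sub_one]
  ring

lemma hasDerivAt_evenSol (x : ℝ) : HasDerivAt evenSol (evenSolDeriv x) x := by
  refine ((((hasDerivAt_cosh_two_mul x).fun_pow 2).sub_const 2).fun_mul
    ((hasDerivAt_sechSqrt x).fun_pow 3)).congr_deriv ?_
  simp only [evenSolDeriv, Nat.cast_ofNat, Nat.add_one_sub_one]
  ring

lemma hasDerivAt_oddSolDeriv (x : ℝ) :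
    HasDerivAt oddSolDeriv ((1 - 15 * sechSqrt x ^ 4) * oddSol x) x := by
  refine ((((hasDerivAt_cosh_two_mul x).const_mul 2).fun_mul
    ((hasDerivAt_sechSqrt x).fun_pow 3)).fun_sub
    ((((hasDerivAt_sinh_two_mul x).fun_pow 2).const_mul 3).fun_mul
    ((hasDerivAt_sechSqrt x).fun_pow 5))).congr_deriv ?_
  simp only [oddSol, Nat.cast_ofNat, Nat.add_one_sub_one]
  have h := sechSqrt_sq_mul_cosh x
  have hs := Real.cosh_sq (2 * x)
  have hw := (sechSqrt_pos x).ne'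
  generalize Real.sinh (2 * x) = s at *
  generalize Real.cosh (2 * x) = c at *
  generalize sechSqrt x = w at *
  have hs2 : s ^ 2 = c ^ 2 - 1 := by linarith
  have h3 : s ^ 3 = s * (c ^ 2 - 1) := by rw [← hs2]; ring
  ring_nf
  simp only [h3]
  linear_combination (15 * s * w ^ 3 * (w ^ 2 * c + 1) - 18 * s * w ^ 3 ) * h

lemma hasDerivAt_evenSolDeriv (x : ℝ) :
    HasDerivAt evenSolDeriv ((1 - 15 * sechSqrt x ^ 4) * evenSol x) x := by
  refine (((((hasDerivAt_cosh_two_mul x).const_mul 4).fun_mul (hasDerivAt_sinh_two_mul x)).fun_mul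
    ((hasDerivAt_sechSqrt x).fun_pow 3)).fun_sub
    ((((((hasDerivAt_cosh_two_mul x).fun_pow 2).sub_const 2).const_mul 3).fun_mul
    (hasDerivAt_sinh_two_mul x)).fun_mul
    ((hasDerivAt_sechSqrt x).fun_pow 5))).congr_deriv ?_
  simp only [evenSol, Nat.cast_ofNat, Nat.add_one_sub_one]
  have h := sechSqrt_sq_mul_cosh x
  have hs := Real.cosh_sq (2 * x)
  have hw := (sechSqrt_pos x).ne'
  generalize Real.sinh (2 * x) = s at *
  generalize Real.cosh (2 * x) = c at *
  generalize sechSqrt x = w at *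
  have hs2 : s ^ 2 = c ^ 2 - 1 := by linarith
  ring_nf
  simp only [hs2]
  have hc : c = 1 / w ^ 2 := by
    field_simp
    linarith
  rw [hc]
  field_simp
  ring

lemma wronskian_eq (x : ℝ) : oddSolDeriv x * evenSol x - oddSol x * evenSolDeriv x = -2 := by
  have h := sechSqrt_sq_mul_cosh x
  have hs := Real.cosh_sq (2 * x)
  have hw := (sechSqrt_pos x).ne'
  simp only [oddSol, evenSol, oddSolDeriv, evenSolDeriv]
  generalize Real.sinh (2 * x) = s at *
  generalize Real.cosh (2 * x) = c at *
  generalize sechSqrt x = w at *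
  have hs2 : s ^ 2 = c ^ 2 - 1 := by linarith
  ring_nf
  simp only [hs2]
  have hc : c = 1 / w ^ 2 := by
    field_simp
    linarith
  rw [hc]
  field_simp
  ring

/-! ### Functions of size `sechSqrt` up to polynomial factors -/

/-- `φ` is bounded by a polynomial times `sechSqrt`. -/
def PolyDecay (φ : ℝ → ℝ) : Prop :=
  ∃ (C : ℝ) (n : ℕ), 0 ≤ C ∧ ∀ x, |φ x| ≤ C * (1 + |x|) ^ n * sechSqrt x

lemma PolyDecay.add {φ ψ : ℝ → ℝ} (hφ : PolyDecay φ) (hψ : PolyDecay ψ) :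
    PolyDecay fun x => φ x + ψ x := by
  obtain ⟨C, n, hC, h⟩ := hφ
  obtain ⟨D, m, hD, h'⟩ := hψ
  refine ⟨C + D, n + m, by positivity, fun x => ?_⟩
  have hw := sechSqrt_pos x
  have h1 : (1 : ℝ) ≤ 1 + |x| := by linarith [abs_nonneg x]
  calc |φ x + ψ x| ≤ |φ x| + |ψ x| := abs_add_le _ _
    _ ≤ C * (1 + |x|) ^ n * sechSqrt x + D * (1 + |x|) ^ m * sechSqrt x := add_le_add (h x) (h' x)
    _ ≤ C * (1 + |x|) ^ (n + m) * sechSqrt x + D * (1 + |x|) ^ (n + m) * sechSqrt x := by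
        gcongr <;> first | assumption | omega
    _ = _ := by ring

lemma PolyDecay.mul_bounded {φ b : ℝ → ℝ} (hφ : PolyDecay φ) {K : ℝ} (hb : ∀ x, |b x| ≤ K) :
    PolyDecay fun x => b x * φ x := by
  obtain ⟨C, n, hC, h⟩ := hφ
  have hK : 0 ≤ K := (abs_nonneg _).trans (hb 0)
  refine ⟨K * C, n, by positivity, fun x => ?_⟩
  rw [abs_mul, mul_assoc K, mul_assoc K]
  exact mul_le_mul (hb x) (h x) (abs_nonneg _) hK

lemma PolyDecay.const_mul {φ : ℝ → ℝ} (hφ : PolyDecay φ) (c : ℝ) : PolyDecay fun x => c * φ x :=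
  hφ.mul_bounded (b := fun _ => c) fun _ => le_rfl

lemma PolyDecay.sub {φ ψ : ℝ → ℝ} (hφ : PolyDecay φ) (hψ : PolyDecay ψ) :
    PolyDecay fun x => φ x - ψ x := by
  simpa [sub_eq_add_neg] using hφ.add (hψ.const_mul (-1))

lemma PolyDecay.sum {ι : Type*} (s : Finset ι) {φ : ι → ℝ → ℝ} (h : ∀ i ∈ s, PolyDecay (φ i)) :
    PolyDecay fun x => ∑ i ∈ s, φ i x := by
  classical
  induction s using Finset.induction_on with
  | empty => exact ⟨0, 0, le_rfl, by simp⟩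
  | insert i s hi ih =>
    simp only [Finset.sum_insert hi]
    exact (h i (Finset.mem_insert_self i s)).add
      (ih fun j hj => h j (Finset.mem_insert_of_mem hj))

lemma polyDecay_iff_le_Q (φ : ℝ → ℝ) :
    PolyDecay φ ↔ ∃ C κ : ℝ, 0 < C ∧ 0 < κ ∧ ∀ x : ℝ, |φ x| ≤ C * (1 + |x|) ^ κ * Q x := by
  set a : ℝ := (3 : ℝ) ^ ((1 : ℝ) / 4) with ha
  have ha0 : 0 < a := by positivity
  constructor
  · rintro ⟨C, n, hC, h⟩
    refine ⟨(C + 1) / a, n + 1, by positivity, by positivity, fun x => (h x).trans ?_⟩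
    have hw := sechSqrt_pos x
    have h1 : (1 : ℝ) ≤ 1 + |x| := by linarith [abs_nonneg x]
    have h2 : (1 + |x|) ^ n ≤ (1 + |x|) ^ ((n : ℝ) + 1) := by
      rw [← Real.rpow_natCast]
      exact Real.rpow_le_rpow_of_exponent_le h1 (by linarith)
    rw [Q_eq_sechSqrt, ← ha]
    calc C * (1 + |x|) ^ n * sechSqrt x ≤ (C + 1) * (1 + |x|) ^ ((n : ℝ) + 1) * sechSqrt x := by
          gcongr
          linarith
      _ = _ := by field_simp
  · rintro ⟨C, κ, hC, hκ, h⟩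
    refine ⟨C * a, ⌈κ⌉₊, by positivity, fun x => (h x).trans ?_⟩
    have hw := sechSqrt_pos x
    have h1 : (1 : ℝ) ≤ 1 + |x| := by linarith [abs_nonneg x]
    have h2 : (1 + |x|) ^ κ ≤ (1 + |x|) ^ ⌈κ⌉₊ := by
      rw [← Real.rpow_natCast]
      exact Real.rpow_le_rpow_of_exponent_le h1 (Nat.le_ceil κ)
    rw [Q_eq_sechSqrt, ← ha]
    calc C * (1 + |x|) ^ κ * (a * sechSqrt x) ≤ C * (1 + |x|) ^ ⌈κ⌉₊ * (a * sechSqrt x) := by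
          gcongr
      _ = _ := by ring

lemma memY_iff (f : ℝ → ℝ) : MemY f ↔ (∀ x, f (-x) = f x) ∧ ContDiff ℝ (⊤ : ℕ∞) f ∧
    ∀ k : ℕ, PolyDecay (iteratedDeriv k f) := by
  simp only [MemY, polyDecay_iff_le_Q]

/-! ### Derivatives of the potential -/

lemma hasDerivAt_tanh_two_mul (x : ℝ) :
    HasDerivAt (fun x => Real.sinh (2 * x) * sechSqrt x ^ 2)
      (2 * (1 - (Real.sinh (2 * x) * sechSqrt x ^ 2) ^ 2)) x := by
  refine ((hasDerivAt_sinh_two_mul x).fun_mul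
    ((hasDerivAt_sechSqrt x).fun_pow 2)).congr_deriv ?_
  simp only [Nat.cast_ofNat, Nat.add_one_sub_one]
  linear_combination 2 * sechSqrt_sq_mul_cosh x

lemma abs_tanh_two_mul_le (x : ℝ) : |Real.sinh (2 * x) * sechSqrt x ^ 2| ≤ 1 := by
  have h := abs_sinh_le_cosh (2 * x)
  rw [abs_mul, abs_of_nonneg (sq_nonneg (sechSqrt x)), ← sechSqrt_sq_mul_cosh x, mul_comm]
  gcongr

lemma iteratedDeriv_polynomial_tanh (k : ℕ) (p : Polynomial ℝ) :
    ∃ q : Polynomial ℝ, iteratedDeriv k (fun x => p.eval (Real.sinh (2 * x) * sechSqrt x ^ 2)) =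
      fun x => q.eval (Real.sinh (2 * x) * sechSqrt x ^ 2) := by
  induction k generalizing p with
  | zero => exact ⟨p, by simp⟩
  | succ k ih =>
    obtain ⟨q, hq⟩ := ih (p.derivative * (2 * (1 - Polynomial.X ^ 2)))
    refine ⟨q, ?_⟩
    rw [iteratedDeriv_succ', ← hq]
    congr 1
    funext x
    refine ((p.hasDerivAt _).comp x (hasDerivAt_tanh_two_mul x)).deriv.trans ?_
    simp

lemma sechSqrt_pow_four (x : ℝ) :
    sechSqrt x ^ 4 = 1 - (Real.sinh (2 * x) * sechSqrt x ^ 2) ^ 2 := by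
  linear_combination -(sechSqrt x ^ 4) * Real.cosh_sq (2 * x)
    + (sechSqrt x ^ 2 * Real.cosh (2 * x) + 1) * sechSqrt_sq_mul_cosh x

lemma exists_bound_iteratedDeriv_sechSqrt_pow_four (k : ℕ) :
    ∃ K, ∀ x, |iteratedDeriv k (fun x => sechSqrt x ^ 4) x| ≤ K := by
  obtain ⟨q, hq⟩ := iteratedDeriv_polynomial_tanh k (1 - Polynomial.X ^ 2)
  obtain ⟨K, hK⟩ := (isCompact_Icc (a := (-1 : ℝ)) (b := 1)).exists_bound_of_continuousOn
    q.continuous.continuousOn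
  refine ⟨K, fun x => ?_⟩
  have h : (fun x => sechSqrt x ^ 4) = fun x =>
      (1 - Polynomial.X ^ 2 : Polynomial ℝ).eval (Real.sinh (2 * x) * sechSqrt x ^ 2) := by
    funext x
    simp [sechSqrt_pow_four]
  rw [h, hq]
  exact hK _ (abs_le.mp (abs_tanh_two_mul_le x))

lemma polyDecay_iteratedDeriv_of_ode {f g : ℝ → ℝ} (hf : ContDiff ℝ (⊤ : ℕ∞) f)
    (hg : ContDiff ℝ (⊤ : ℕ∞) g) (hgd : ∀ k, PolyDecay (iteratedDeriv k g))
    (h0 : PolyDecay f) (h1 : PolyDecay (deriv f))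
    (hode : ∀ x, deriv (deriv f) x = f x - 15 * (sechSqrt x ^ 4 * f x) - g x) (k : ℕ) :
    PolyDecay (iteratedDeriv k f) := by
  induction k using Nat.strong_induction_on with
  | _ k ih =>
  match k with
  | 0 => simpa using h0
  | 1 => simpa [iteratedDeriv_one] using h1
  | k + 2 =>
    have hV : ContDiff ℝ (⊤ : ℕ∞) (fun x => sechSqrt x ^ 4) := contDiff_sechSqrt.pow 4
    have hle : (k : WithTop ℕ∞) ≤ ((⊤ : ℕ∞) : WithTop ℕ∞) := by exact_mod_cast le_top
    have hfk (x : ℝ) : ContDiffAt ℝ k f x := (hf.of_le hle).contDiffAt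
    have hgk (x : ℝ) : ContDiffAt ℝ k g x := (hg.of_le hle).contDiffAt
    have hVk (x : ℝ) : ContDiffAt ℝ k (fun x => sechSqrt x ^ 4) x := (hV.of_le hle).contDiffAt
    have heq : iteratedDeriv (k + 2) f = fun x => iteratedDeriv k f x
        - 15 * (∑ i ∈ Finset.range (k + 1), (k.choose i : ℝ) *
          iteratedDeriv i (fun x => sechSqrt x ^ 4) x * iteratedDeriv (k - i) f x)
        - iteratedDeriv k g x := by
      funext x
      rw [iteratedDeriv_succ', iteratedDeriv_succ', funext hode,
        iteratedDeriv_fun_sub ((hfk x).sub (contDiffAt_const.mul ((hVk x).mul (hfk x)))) (hgk x),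
        iteratedDeriv_fun_sub (hfk x) (contDiffAt_const.mul ((hVk x).mul (hfk x))),
        iteratedDeriv_const_mul _ ((hVk x).mul (hfk x)),
        iteratedDeriv_fun_mul (hVk x) (hfk x)]
    rw [heq]
    refine ((ih k (by omega)).sub ((PolyDecay.sum _ fun i _ => ?_).const_mul 15)).sub (hgd k)
    obtain ⟨K, hK⟩ := exists_bound_iteratedDeriv_sechSqrt_pow_four i
    refine (ih (k - i) (by omega)).mul_bounded (K := k.choose i * K) fun x => ?_
    rw [abs_mul, Nat.abs_cast]
    gcongr
    exact hK x

/-! ### Bounds on the homogeneous solutions -/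

lemma one_le_cosh_two_mul (x : ℝ) : 1 ≤ Real.cosh (2 * x) := Real.one_le_cosh _

lemma abs_oddSol_le (x : ℝ) : |oddSol x| ≤ sechSqrt x := by
  have h := abs_tanh_two_mul_le x
  have hw := sechSqrt_pos x
  have : oddSol x = (Real.sinh (2 * x) * sechSqrt x ^ 2) * sechSqrt x := by
    rw [oddSol]
    ring
  rw [this, abs_mul, abs_of_pos hw]
  exact mul_le_of_le_one_left hw.le h

lemma abs_evenSol_factor_le (x : ℝ) : |Real.cosh (2 * x) ^ 2 - 2| ≤ Real.cosh (2 * x) ^ 2 := by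
  have := one_le_cosh_two_mul x
  rw [abs_le]
  constructor <;> nlinarith

lemma abs_evenSol_le (x : ℝ) : |evenSol x| ≤ Real.cosh (2 * x) * sechSqrt x := by
  have hw := sechSqrt_pos x
  have h := sechSqrt_sq_mul_cosh x
  rw [evenSol, abs_mul, abs_of_pos (pow_pos hw 3)]
  calc _ ≤ Real.cosh (2 * x) ^ 2 * sechSqrt x ^ 3 := by
        gcongr
        exact abs_evenSol_factor_le x
    _ = _ := by linear_combination (Real.cosh (2 * x) * sechSqrt x) * h

lemma abs_oddSolDeriv_le (x : ℝ) : |oddSolDeriv x| ≤ 5 * sechSqrt x := by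
  have hw := sechSqrt_pos x
  have h := sechSqrt_sq_mul_cosh x
  have ht := abs_tanh_two_mul_le x
  have heq : oddSolDeriv x =
      2 * sechSqrt x - 3 * (Real.sinh (2 * x) * sechSqrt x ^ 2) ^ 2 * sechSqrt x := by
    rw [oddSolDeriv]
    linear_combination 2 * sechSqrt x * h
  rw [heq]
  have ht2 := (sq_le_one_iff_abs_le_one _).mpr ht
  have ht3 := sq_nonneg (Real.sinh (2 * x) * sechSqrt x ^ 2)
  rw [abs_le]
  constructor <;> nlinarith

lemma abs_evenSolDeriv_le (x : ℝ) : |evenSolDeriv x| ≤ 7 * (Real.cosh (2 * x) * sechSqrt x) := by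
  have hw := sechSqrt_pos x
  have h := sechSqrt_sq_mul_cosh x
  have ht := abs_tanh_two_mul_le x
  have hc := one_le_cosh_two_mul x
  have heq : evenSolDeriv x = (Real.sinh (2 * x) * sechSqrt x ^ 2) *
      ((Real.cosh (2 * x) + 6 * sechSqrt x ^ 2) * sechSqrt x) := by
    rw [evenSolDeriv]
    linear_combination
      (-3 * Real.cosh (2 * x) * Real.sinh (2 * x) * sechSqrt x ^ 3) * h
  have hw2 : sechSqrt x ^ 2 ≤ 1 := by nlinarith [sq_nonneg (sechSqrt x)]
  rw [heq, abs_mul, abs_of_pos (by positivity : 0 < (Real.cosh (2 * x) + 6 * sechSqrt x ^ 2) *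
    sechSqrt x)]
  refine (mul_le_of_le_one_left (by positivity) ht).trans ?_
  rw [← mul_assoc]
  gcongr
  linarith

lemma exp_le_two_mul_cosh (x : ℝ) : Real.exp x ≤ 2 * Real.cosh x := by
  rw [Real.cosh_eq]
  linarith [Real.exp_pos (-x)]

lemma cosh_le_exp {x : ℝ} (hx : 0 ≤ x) : Real.cosh x ≤ Real.exp x := by
  rw [Real.cosh_eq]
  linarith [Real.exp_le_exp.mpr (by linarith : -x ≤ x)]

/-! ### Tail integrals -/

lemma polynomial_div_cosh_le {x y : ℝ} (hx : 0 ≤ x) (hxy : x ≤ y) (n : ℕ) :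
    (1 + y) ^ n / Real.cosh (2 * y) ≤
      (2 * n.factorial * Real.exp 1 * ((1 + x) ^ n / Real.cosh (2 * x)) * Real.exp x)
        * Real.exp (-y) := by
  have h1 : (1 + y) ^ n ≤ (1 + x) ^ n * (n.factorial * Real.exp (1 + (y - x))) := by
    have h2 := Real.pow_div_factorial_le_exp (1 + (y - x)) (by linarith) n
    rw [div_le_iff₀ (by positivity)] at h2
    calc (1 + y) ^ n ≤ ((1 + x) * (1 + (y - x))) ^ n := by
          gcongr
          · linarith
          · nlinarith
      _ = (1 + x) ^ n * (1 + (y - x)) ^ n := mul_pow _ _ _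
      _ ≤ _ := by
          gcongr
          linarith
  have h3 : 1 / Real.cosh (2 * y) ≤ 2 * Real.exp (-(2 * (y - x))) / Real.cosh (2 * x) := by
    have hcy := Real.cosh_pos (2 * y)
    have hcx := Real.cosh_pos (2 * x)
    rw [div_le_div_iff₀ hcy hcx]
    calc 1 * Real.cosh (2 * x) ≤ Real.exp (2 * x) := by
          rw [one_mul]
          exact cosh_le_exp (by linarith)
      _ = Real.exp (-(2 * (y - x))) * Real.exp (2 * y) := by
          rw [← Real.exp_add]
          ring_nf
      _ ≤ Real.exp (-(2 * (y - x))) * (2 * Real.cosh (2 * y)) := by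
          gcongr
          exact exp_le_two_mul_cosh _
      _ = _ := by ring
  have hcy := Real.cosh_pos (2 * y)
  calc (1 + y) ^ n / Real.cosh (2 * y) = (1 + y) ^ n * (1 / Real.cosh (2 * y)) := by ring
    _ ≤ ((1 + x) ^ n * (n.factorial * Real.exp (1 + (y - x)))) *
        (2 * Real.exp (-(2 * (y - x))) / Real.cosh (2 * x)) := by
        gcongr
    _ = 2 * n.factorial * ((1 + x) ^ n / Real.cosh (2 * x)) *
        (Real.exp (1 + (y - x)) * Real.exp (-(2 * (y - x)))) := by ring
    _ = 2 * n.factorial * ((1 + x) ^ n / Real.cosh (2 * x)) *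
        (Real.exp 1 * Real.exp x * Real.exp (-y)) := by
        simp only [← Real.exp_add]
        ring_nf
    _ = _ := by ring

lemma tail_integral_bound {φ : ℝ → ℝ} (hφ : Continuous φ) {C : ℝ} {n : ℕ} (hC : 0 ≤ C)
    (h : ∀ y, |φ y| ≤ C * ((1 + |y|) ^ n / Real.cosh (2 * y))) {x : ℝ} (hx : 0 ≤ x) :
    IntegrableOn φ (Ioi x) ∧ |∫ y in Ioi x, φ y| ≤
      C * (2 * n.factorial * Real.exp 1) * ((1 + x) ^ n / Real.cosh (2 * x)) := by
  set M : ℝ := 2 * n.factorial * Real.exp 1 * ((1 + x) ^ n / Real.cosh (2 * x)) * Real.exp x with hM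
  have hint : IntegrableOn (fun y => C * (M * Real.exp (-y))) (Ioi x) :=
    ((integrableOn_exp_neg_Ioi x).const_mul M).const_mul C
  have hbd : ∀ᵐ y ∂volume.restrict (Ioi x), ‖φ y‖ ≤ C * (M * Real.exp (-y)) := by
    filter_upwards [ae_restrict_mem measurableSet_Ioi] with y hy
    have hxy : x ≤ y := le_of_lt hy
    refine (h y).trans ?_
    rw [abs_of_nonneg (hx.trans hxy)]
    gcongr
    exact polynomial_div_cosh_le hx hxy n
  refine ⟨hint.mono' hφ.aestronglyMeasurable.restrict hbd,
    (norm_integral_le_of_norm_le hint hbd).trans_eq ?_⟩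
  rw [integral_const_mul, integral_const_mul, integral_exp_neg_Ioi, hM]
  have : Real.exp x * Real.exp (-x) = 1 := by rw [← Real.exp_add]; simp
  linear_combination C * (2 * n.factorial * Real.exp 1) *
    ((1 + x) ^ n / Real.cosh (2 * x)) * this

/-! ### Existence by variation of constants -/

lemma contDiff_oddSol : ContDiff ℝ (⊤ : ℕ∞) oddSol :=
  (Real.contDiff_sinh.comp (contDiff_const.mul contDiff_id)).mul (contDiff_sechSqrt.pow 3)

lemma contDiff_evenSol : ContDiff ℝ (⊤ : ℕ∞) evenSol :=
  (((Real.contDiff_cosh.comp (contDiff_const.mul contDiff_id)).pow 2).sub contDiff_const).mul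
    (contDiff_sechSqrt.pow 3)

lemma oddSol_neg (x : ℝ) : oddSol (-x) = -oddSol x := by
  simp [oddSol, sechSqrt_neg]

lemma evenSol_neg (x : ℝ) : evenSol (-x) = evenSol x := by
  simp [evenSol, sechSqrt_neg]

lemma exists_variation_coefficients {g : ℝ → ℝ} (heven : ∀ x, g (-x) = g x) (hg : Continuous g)
    (hdec : PolyDecay g) :
    ∃ A B : ℝ → ℝ, (∀ x, HasDerivAt A (evenSol x * g x / 2) x) ∧
      (∀ x, HasDerivAt B (-(oddSol x * g x / 2)) x) ∧
      (∀ x, A (-x) = -A x) ∧ (∀ x, B (-x) = B x) ∧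
      ∃ (C : ℝ) (n : ℕ), 0 ≤ C ∧ (∀ x, |A x| ≤ C * (1 + |x|) ^ n) ∧
        ∀ x, |B x| ≤ C * (1 + |x|) ^ n / Real.cosh (2 * x) := by
  obtain ⟨D, m, hD, hgb⟩ := hdec
  set α : ℝ → ℝ := fun x => evenSol x * g x / 2 with hα
  set β : ℝ → ℝ := fun x => oddSol x * g x / 2 with hβ
  have hαc : Continuous α := (contDiff_evenSol.continuous.mul hg).div_const 2
  have hβc : Continuous β := (contDiff_oddSol.continuous.mul hg).div_const 2
  have hαb (x : ℝ) : |α x| ≤ D * (1 + |x|) ^ m := by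
    have h1 : |evenSol x * g x| ≤
        (Real.cosh (2 * x) * sechSqrt x) * (D * (1 + |x|) ^ m * sechSqrt x) := by
      rw [abs_mul]
      exact mul_le_mul (abs_evenSol_le x) (hgb x) (abs_nonneg _)
        (mul_pos (Real.cosh_pos _) (sechSqrt_pos x)).le
    have h2 : (Real.cosh (2 * x) * sechSqrt x) * (D * (1 + |x|) ^ m * sechSqrt x) =
        D * (1 + |x|) ^ m := by
      linear_combination D * (1 + |x|) ^ m * sechSqrt_sq_mul_cosh x
    rw [hα, abs_div, abs_two]
    linarith [abs_nonneg (evenSol x * g x)]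
  have hβb (x : ℝ) : |β x| ≤ D * ((1 + |x|) ^ m / Real.cosh (2 * x)) := by
    have h1 : |oddSol x * g x| ≤ sechSqrt x * (D * (1 + |x|) ^ m * sechSqrt x) := by
      rw [abs_mul]
      exact mul_le_mul (abs_oddSol_le x) (hgb x) (abs_nonneg _) (sechSqrt_pos x).le
    have h2 : sechSqrt x * (D * (1 + |x|) ^ m * sechSqrt x) =
        D * ((1 + |x|) ^ m / Real.cosh (2 * x)) := by
      linear_combination D * (1 + |x|) ^ m * sechSqrt_sq x
    rw [hβ, abs_div, abs_two]
    linarith [abs_nonneg (oddSol x * g x)]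
  have hαe (x : ℝ) : α (-x) = α x := by simp [hα, evenSol_neg, heven]
  have hβo (x : ℝ) : β (-x) = -β x := by simp [hβ, oddSol_neg, heven, neg_div]
  have hBe (x : ℝ) : ∫ t in (0 : ℝ)..(-x), β t = ∫ t in (0 : ℝ)..x, β t := by
    have h := intervalIntegral.integral_comp_neg (a := 0) (b := x) β
    simp only [hβo, intervalIntegral.integral_neg, neg_zero] at h
    rw [intervalIntegral.integral_symm, ← h, neg_neg]
  set B : ℝ → ℝ := fun x => (∫ t in Ioi (0 : ℝ), β t) - ∫ t in (0 : ℝ)..x, β t with hB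
  have hBeven (x : ℝ) : B (-x) = B x := by simp only [hB, hBe]
  set K : ℝ := D * (2 * m.factorial * Real.exp 1) with hK
  have hK0 : 0 ≤ K := by positivity
  have hBpos {x : ℝ} (hx : 0 ≤ x) : |B x| ≤ K * ((1 + x) ^ m / Real.cosh (2 * x)) := by
    have h := tail_integral_bound hβc hD hβb hx
    have h' := intervalIntegral.integral_interval_add_Ioi
      (tail_integral_bound hβc hD hβb le_rfl).1 h.1
    have : B x = ∫ t in Ioi x, β t := by
      rw [hB]
      linarith
    rw [this]
    exact h.2
  have hBabs (x : ℝ) : |B x| ≤ K * ((1 + |x|) ^ m / Real.cosh (2 * x)) := by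
    have h := hBpos (abs_nonneg x)
    rcases abs_cases x with ⟨hx, -⟩ | ⟨hx, -⟩
    · rwa [hx] at h ⊢
    · rwa [hx, hBeven, mul_neg, Real.cosh_neg, ← hx] at h
  refine ⟨fun x => ∫ t in (0 : ℝ)..x, α t, B,
    fun x => (hαc.integral_hasStrictDerivAt 0 x).hasDerivAt,
    fun x => ((hβc.integral_hasStrictDerivAt 0 x).hasDerivAt).const_sub _, fun x => ?_, hBeven,
    D + K, m + 1, by positivity, fun x => ?_, fun x => ?_⟩
  · have h := intervalIntegral.integral_comp_neg (a := 0) (b := x) α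
    simp only [hαe, neg_zero] at h
    change ∫ t in (0 : ℝ)..(-x), α t = -∫ t in (0 : ℝ)..x, α t
    rw [h, intervalIntegral.integral_symm]
  · have hx := abs_nonneg x
    have h : |∫ t in (0 : ℝ)..x, α t| ≤ D * (1 + |x|) ^ m * |x - 0| := by
      rw [← Real.norm_eq_abs]
      refine intervalIntegral.norm_integral_le_of_norm_le_const fun t ht => ?_
      refine (hαb t).trans ?_
      have ht' : |t| ≤ |x| := by
        rcases le_total 0 x with h0 | h0
        · rw [uIoc_of_le h0] at ht
          rw [abs_of_nonneg h0, abs_of_pos ht.1]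
          exact ht.2
        · rw [uIoc_of_ge h0] at ht
          rw [abs_of_nonpos h0, abs_of_nonpos ht.2]
          linarith [ht.1]
      gcongr
    rw [sub_zero] at h
    calc _ ≤ D * (1 + |x|) ^ m * |x| := h
      _ ≤ (D + K) * (1 + |x|) ^ m * (1 + |x|) := by
          gcongr <;> linarith
      _ = _ := by ring
  · have hx : 1 ≤ 1 + |x| := by linarith [abs_nonneg x]
    have hc := Real.cosh_pos (2 * x)
    refine (hBabs x).trans ?_
    rw [← mul_div_assoc]
    gcongr
    · linarith
    · omega

theorem exists_memY_solution {g : ℝ → ℝ} (hg : MemY g) :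
    ∃ f : ℝ → ℝ, MemY f ∧
      ∀ x : ℝ, -(deriv (deriv f) x) + f x - 5 * (Q x) ^ 4 * f x = g x := by
  obtain ⟨heven, hsmooth, hdec⟩ := (memY_iff g).mp hg
  obtain ⟨A, B, hA, hB, hAodd, hBeven, C, n, hC, hAb, hBb⟩ :=
    exists_variation_coefficients heven hsmooth.continuous (by simpa using hdec 0)
  set f : ℝ → ℝ := fun x => A x * oddSol x + B x * evenSol x with hf
  set f₁ : ℝ → ℝ := fun x => A x * oddSolDeriv x + B x * evenSolDeriv x with hf₁
  have hf' (x : ℝ) : HasDerivAt f (f₁ x) x := by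
    refine (((hA x).fun_mul (hasDerivAt_oddSol x)).fun_add
      ((hB x).fun_mul (hasDerivAt_evenSol x))).congr_deriv ?_
    simp only [hf₁]
    ring
  have hf'' (x : ℝ) : HasDerivAt f₁ (f x - 15 * (sechSqrt x ^ 4 * f x) - g x) x := by
    refine (((hA x).fun_mul (hasDerivAt_oddSolDeriv x)).fun_add
      ((hB x).fun_mul (hasDerivAt_evenSolDeriv x))).congr_deriv ?_
    simp only [hf]
    linear_combination g x / 2 * wronskian_eq x
  have hderiv : deriv f = f₁ := funext fun x => (hf' x).deriv
  have hode (x : ℝ) : deriv (deriv f) x = f x - 15 * (sechSqrt x ^ 4 * f x) - g x := by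
    rw [hderiv]
    exact (hf'' x).deriv
  have hAs : ContDiff ℝ (⊤ : ℕ∞) A := by
    rw [contDiff_infty_iff_deriv, funext fun x => (hA x).deriv]
    exact ⟨fun x => (hA x).differentiableAt, (contDiff_evenSol.mul hsmooth).div_const 2⟩
  have hBs : ContDiff ℝ (⊤ : ℕ∞) B := by
    rw [contDiff_infty_iff_deriv, funext fun x => (hB x).deriv]
    exact ⟨fun x => (hB x).differentiableAt, ((contDiff_oddSol.mul hsmooth).div_const 2).neg⟩
  have hfs : ContDiff ℝ (⊤ : ℕ∞) f :=
    (hAs.mul contDiff_oddSol).add (hBs.mul contDiff_evenSol)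
  have hcomb {u v : ℝ → ℝ} {a b : ℝ} (ha : 0 ≤ a) (hb : 0 ≤ b)
      (hu : ∀ x, |u x| ≤ a * sechSqrt x)
      (hv : ∀ x, |v x| ≤ b * (Real.cosh (2 * x) * sechSqrt x)) :
      PolyDecay fun x => A x * u x + B x * v x := by
    refine ⟨C * (a + b), n, by positivity, fun x => ?_⟩
    have hc := Real.cosh_pos (2 * x)
    have hx := abs_nonneg x
    have hw := sechSqrt_pos x
    calc |A x * u x + B x * v x| ≤ |A x| * |u x| + |B x| * |v x| := by
          rw [← abs_mul, ← abs_mul]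
          exact abs_add_le _ _
      _ ≤ C * (1 + |x|) ^ n * (a * sechSqrt x) + C * (1 + |x|) ^ n / Real.cosh (2 * x) *
          (b * (Real.cosh (2 * x) * sechSqrt x)) :=
          add_le_add (mul_le_mul (hAb x) (hu x) (abs_nonneg _) (by positivity))
            (mul_le_mul (hBb x) (hv x) (abs_nonneg _) (by positivity))
      _ = _ := by
          field_simp
  have h0 : PolyDecay f := hcomb zero_le_one zero_le_one
    (fun x => by simpa using abs_oddSol_le x) (fun x => by simpa using abs_evenSol_le x)
  have h1 : PolyDecay (deriv f) := by
    rw [hderiv]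
    exact hcomb (by norm_num) (by norm_num) abs_oddSolDeriv_le abs_evenSolDeriv_le
  refine ⟨f, (memY_iff f).mpr ⟨fun x => ?_, hfs,
    polyDecay_iteratedDeriv_of_ode hfs hsmooth hdec h0 h1 hode⟩, fun x => ?_⟩
  · simp only [hf, hAodd, hBeven, oddSol_neg, evenSol_neg]
    ring
  · rw [hode, Q_pow_four]
    ring

/-! ### Uniqueness -/

lemma eq_zero_of_polyDecay_const_mul_evenSol {a : ℝ} (h : PolyDecay fun x => a * evenSol x) :
    a = 0 := by
  obtain ⟨C, n, hC, h⟩ := h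
  by_contra ha
  have ha' : 0 < |a| := abs_pos.mpr ha
  set K : ℝ := 4 * (C * (n.factorial * Real.exp 1)) with hK
  have hK0 : 0 ≤ K := by positivity
  set x : ℝ := 1 + K / |a| with hx
  have hx1 : 1 ≤ x := by
    rw [hx]
    linarith [div_nonneg hK0 ha'.le]
  have hw := sechSqrt_pos x
  have hcosh : Real.exp (2 * x) ≤ 2 * Real.cosh (2 * x) := exp_le_two_mul_cosh _
  have hexp : 2 * x + 1 ≤ Real.exp (2 * x) := Real.add_one_le_exp _
  have hsq := Real.quadratic_le_exp_of_nonneg (by linarith : 0 ≤ 2 * x)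
  have hc2 : 2 ≤ Real.cosh (2 * x) := by nlinarith
  have hpow : (1 + |x|) ^ n ≤ n.factorial * Real.exp 1 * Real.exp x := by
    have h2 := Real.pow_div_factorial_le_exp (1 + x) (by linarith) n
    rw [div_le_iff₀ (by positivity), Real.exp_add] at h2
    rw [abs_of_nonneg (by linarith)]
    linarith
  have hlow : Real.cosh (2 * x) / 2 * sechSqrt x ≤ |evenSol x| := by
    refine le_trans ?_ (le_abs_self _)
    have : evenSol x = (Real.cosh (2 * x) - 2 * sechSqrt x ^ 2) * sechSqrt x := by
      rw [evenSol]
      linear_combination Real.cosh (2 * x) * sechSqrt x * sechSqrt_sq_mul_cosh x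
    rw [this]
    gcongr
    have := sechSqrt_sq_mul_cosh x
    nlinarith [sq_nonneg (sechSqrt x)]
  have hmain : |a| * (Real.cosh (2 * x) / 2) ≤ C * (1 + |x|) ^ n := by
    refine le_of_mul_le_mul_right ?_ hw
    refine le_trans ?_ (h x)
    rw [abs_mul, mul_assoc]
    gcongr
  have hE : Real.exp (2 * x) = Real.exp x * Real.exp x := by
    rw [← Real.exp_add]
    ring_nf
  have hfin : |a| * Real.exp x * Real.exp x ≤ K * Real.exp x := by
    calc |a| * Real.exp x * Real.exp x = |a| * Real.exp (2 * x) := by rw [hE]; ring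
      _ ≤ |a| * (2 * Real.cosh (2 * x)) := by gcongr
      _ ≤ 4 * (C * (1 + |x|) ^ n) := by linarith
      _ ≤ 4 * (C * (n.factorial * Real.exp 1 * Real.exp x)) := by gcongr
      _ = _ := by rw [hK]; ring
  have hfin' := le_of_mul_le_mul_right hfin (Real.exp_pos x)
  have : |a| * (x + 1) ≤ |a| * Real.exp x := by
    gcongr
    exact Real.add_one_le_exp x
  have hax : |a| * x = |a| + K := by
    rw [hx]
    field_simp
  linarith

lemma wronskian_const {h u u' : ℝ → ℝ} (V : ℝ → ℝ) (hh : ∀ x, HasDerivAt h (deriv h x) x)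
    (hh' : ∀ x, HasDerivAt (deriv h) (V x * h x) x) (hu : ∀ x, HasDerivAt u (u' x) x)
    (hu' : ∀ x, HasDerivAt u' (V x * u x) x) (x : ℝ) :
    h x * u' x - deriv h x * u x = h 0 * u' 0 - deriv h 0 * u 0 := by
  have hd (x : ℝ) : HasDerivAt (fun x => h x * u' x - deriv h x * u x) 0 x := by
    refine (((hh x).fun_mul (hu' x)).fun_sub ((hh' x).fun_mul (hu x))).congr_deriv ?_
    ring
  exact is_const_of_deriv_eq_zero (fun x => (hd x).differentiableAt) (fun x => (hd x).deriv) x 0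

lemma eq_zero_of_homogeneous {h : ℝ → ℝ} (heven : ∀ x, h (-x) = h x)
    (hs : ContDiff ℝ (⊤ : ℕ∞) h) (hdec : PolyDecay h)
    (hode : ∀ x, deriv (deriv h) x = (1 - 15 * sechSqrt x ^ 4) * h x) (x : ℝ) : h x = 0 := by
  have hs' := (contDiff_infty_iff_deriv.mp hs).2
  have hh (x : ℝ) : HasDerivAt h (deriv h x) x :=
    ((hs.differentiable (by simp)) x).hasDerivAt
  have hh' (x : ℝ) : HasDerivAt (deriv h) ((1 - 15 * sechSqrt x ^ 4) * h x) x := by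
    rw [← hode]
    exact ((hs'.differentiable (by simp)) x).hasDerivAt
  have hd0 : deriv h 0 = 0 := by
    have h1 := deriv_comp_neg h 0
    simp only [heven, neg_zero] at h1
    linarith
  have hrep (x : ℝ) : h x = -h 0 * evenSol x := by
    have h1 := wronskian_const _ hh hh' hasDerivAt_evenSol hasDerivAt_evenSolDeriv x
    have h2 := wronskian_const _ hh hh' hasDerivAt_oddSol hasDerivAt_oddSolDeriv x
    have e1 : evenSolDeriv 0 = 0 := by simp [evenSolDeriv]
    have e2 : oddSolDeriv 0 = 2 := by simp [oddSolDeriv, sechSqrt]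
    rw [hd0, e1] at h1
    rw [hd0, e2] at h2
    linear_combination h x / 2 * wronskian_eq x + oddSol x / 2 * h1 - evenSol x / 2 * h2
  have h0 : -h 0 = 0 := by
    refine eq_zero_of_polyDecay_const_mul_evenSol ?_
    rwa [← funext hrep]
  rw [hrep, h0, zero_mul]

theorem memY_solution_unique {f₁ f₂ g : ℝ → ℝ} (h₁ : MemY f₁) (h₂ : MemY f₂)
    (hode₁ : ∀ x, -(deriv (deriv f₁) x) + f₁ x - 5 * (Q x) ^ 4 * f₁ x = g x)
    (hode₂ : ∀ x, -(deriv (deriv f₂) x) + f₂ x - 5 * (Q x) ^ 4 * f₂ x = g x) : f₁ = f₂ := by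
  obtain ⟨heven₁, hs₁, hdec₁⟩ := (memY_iff f₁).mp h₁
  obtain ⟨heven₂, hs₂, hdec₂⟩ := (memY_iff f₂).mp h₂
  have hd₁ := contDiff_infty_iff_deriv.mp hs₁
  have hd₂ := contDiff_infty_iff_deriv.mp hs₂
  have hderiv : deriv (fun x => f₁ x - f₂ x) = fun x => deriv f₁ x - deriv f₂ x :=
    funext fun x => deriv_fun_sub (hd₁.1 x) (hd₂.1 x)
  funext x
  refine sub_eq_zero.mp (eq_zero_of_homogeneous (h := fun x => f₁ x - f₂ x)
    (fun x => by rw [heven₁, heven₂]) (hs₁.sub hs₂)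
    (PolyDecay.sub (by simpa using hdec₁ 0) (by simpa using hdec₂ 0)) (fun x => ?_) x)
  rw [hderiv, deriv_fun_sub (hd₁.2.differentiable (by simp) x) (hd₂.2.differentiable (by simp) x)]
  have e₁ := hode₁ x
  have e₂ := hode₂ x
  rw [Q_pow_four] at e₁ e₂
  linear_combination e₂ - e₁

/-- Solvability of `L₊`: for every `g ∈ 𝒴` there is a unique `f ∈ 𝒴` with
`L₊ f = −f'' + f − 5Q⁴f = g`. -/
theorem Lplus_solvable (g : ℝ → ℝ) (hg : MemY g) :
    ∃! f : ℝ → ℝ, MemY f ∧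
      ∀ x : ℝ, -(deriv (deriv f) x) + f x - 5 * (Q x) ^ 4 * f x = g x := by
  obtain ⟨f, hf, hode⟩ := exists_memY_solution hg
  exact ⟨f, ⟨hf, hode⟩, fun _ h => memY_solution_unique h.1 hf h.2 hode⟩
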